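/- arXiv:2109.07075 — 6 statements merged into one kernel-verified Lean document; each statement's English description precedes it below -/
import Mathlib

section
/- Let Ω ⊆ ℝⁿ be a nonempty closed convex set, let α ∈ ℝⁿ, and let β ≥ 0 be such that dist(α, Ω) ≥ β. Then the minimum of z ↦ dist(z, Ω) over the closed ball of center α and radius β equals dist(α, Ω) − β, and this minimum is attained at the point x* = α − β·(α − proj_Ω(α))/‖α − proj_Ω(α)‖ when dist(α, Ω) > 0. -/
/-- A point of a set minimizing the distance to `x` realizes the infimum distance. -/
theorem infDist_eq_norm_sub_of_forall_le {E : Type*} [SeminormedAddCommGroup E]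
    {s : Set E} {x p : E} (hp : p ∈ s) (hmin : ∀ z ∈ s, ‖x - p‖ ≤ ‖x - z‖) :
    Metric.infDist x s = ‖x - p‖ := by
  refine le_antisymm ?_ ((Metric.le_infDist ⟨p, hp⟩).2 fun z hz => ?_)
  · simpa only [dist_eq_norm] using Metric.infDist_le_dist_of_mem (x := x) hp
  · simpa only [dist_eq_norm] using hmin z hz

/-- Points of a closed ball are at most its radius closer to a set than its center is. -/
theorem infDist_sub_le_infDist_of_mem_closedBall {X : Type*} [PseudoMetricSpace X]
    {s : Set X} {x z : X} {r : ℝ} (hz : z ∈ Metric.closedBall x r) :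
    Metric.infDist x s - r ≤ Metric.infDist z s := by
  have h := Metric.infDist_le_infDist_add_dist (s := s) (x := x) (y := z)
  rw [Metric.mem_closedBall'] at hz
  linarith

/-- If `dist(α, Ω) ≥ β ≥ 0` for a nonempty closed convex `Ω`, then the minimum of
`z ↦ dist(z, Ω)` over the closed ball of center `α` and radius `β` equals
`dist(α, Ω) − β`, and when `dist(α, Ω) > 0` this minimum is attained at
`x* = α − β·(α − proj_Ω(α))/‖α − proj_Ω(α)‖`, where `p = proj_Ω(α)`. -/
theorem min_dist_over_ball (n : ℕ) (Ω : Set (EuclideanSpace ℝ (Fin n)))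
    (hΩne : Ω.Nonempty) (hΩcl : IsClosed Ω) (hΩcv : Convex ℝ Ω)
    (α : EuclideanSpace ℝ (Fin n)) (β : ℝ) (hβ : 0 ≤ β)
    (hd : β ≤ Metric.infDist α Ω)
    (p : EuclideanSpace ℝ (Fin n)) (hp : p ∈ Ω)
    (hproj : ∀ z ∈ Ω, ‖α - p‖ ≤ ‖α - z‖) :
    IsLeast ((fun z => Metric.infDist z Ω) '' Metric.closedBall α β)
        (Metric.infDist α Ω - β) ∧
      (0 < Metric.infDist α Ω →
        α - (β / ‖α - p‖) • (α - p) ∈ Metric.closedBall α β ∧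
        Metric.infDist (α - (β / ‖α - p‖) • (α - p)) Ω = Metric.infDist α Ω - β) := by
  have hD : Metric.infDist α Ω = ‖α - p‖ := infDist_eq_norm_sub_of_forall_le hp hproj
  have hattained : 0 < Metric.infDist α Ω →
      α - (β / ‖α - p‖) • (α - p) ∈ Metric.closedBall α β ∧
      Metric.infDist (α - (β / ‖α - p‖) • (α - p)) Ω = Metric.infDist α Ω - β := by
    intro hpos
    rw [hD] at hpos hd
    have hball : α - (β / ‖α - p‖) • (α - p) ∈ Metric.closedBall α β := by
      rw [mem_closedBall_iff_norm', sub_sub_cancel, norm_smul, Real.norm_of_nonneg (by positivity),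
        div_mul_cancel₀ _ hpos.ne']
    refine ⟨hball, le_antisymm ?_ (infDist_sub_le_infDist_of_mem_closedBall hball)⟩
    have hfactor : α - (β / ‖α - p‖) • (α - p) - p = (1 - β / ‖α - p‖) • (α - p) := by
      module
    calc Metric.infDist (α - (β / ‖α - p‖) • (α - p)) Ω
        ≤ ‖α - (β / ‖α - p‖) • (α - p) - p‖ := by
          simpa only [dist_eq_norm] using Metric.infDist_le_dist_of_mem hp
      _ = (1 - β / ‖α - p‖) * ‖α - p‖ := by
          rw [hfactor, norm_smul,
            Real.norm_of_nonneg (sub_nonneg.2 ((div_le_one hpos).2 hd))]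
      _ = Metric.infDist α Ω - β := by
          rw [hD, sub_mul, one_mul, div_mul_cancel₀ _ hpos.ne']
  refine ⟨⟨?_, ?_⟩, hattained⟩
  · rcases (Metric.infDist_nonneg (x := α) (s := Ω)).eq_or_lt with h | h
    · have hβ0 : β = 0 := le_antisymm (hd.trans h.ge) hβ
      exact ⟨α, Metric.mem_closedBall_self hβ, by simp [hβ0]⟩
    · exact ⟨_, hattained h⟩
  · rintro _ ⟨z, hz, rfl⟩
    exact infDist_sub_le_infDist_of_mem_closedBall hz
end

section
/- Let Ω ⊆ ℝⁿ be a nonempty closed convex set and let 0 < γ < 1. Define V_c : ℝⁿ × ℝⁿ → ℝ by V_c(x_P, x_E) = dist(α, Ω) − β, where α = (x_E − γ²x_P)/(1 − γ²) and β = γ‖x_E − x_P‖/(1 − γ²). Then at every point (x_P, x_E) with x_P ≠ x_E and α ∉ Ω, V_c is differentiable, with partial gradient with respect to x_P equal to (1/(1 − γ²))(−γ²u + γw) and partial gradient with respect to x_E equal to (1/(1 − γ²))(u − γw), where u = (α − proj_Ω(α))/‖α − proj_Ω(α)‖ and w = (x_E − x_P)/‖x_E − x_P‖. In particular V_c is continuously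 differentiable on the open set {(x_P, x_E) : x_P ≠ x_E, α ∉ Ω}. -/
theorem Metric.infDist_eq_norm_sub_of_forall_norm_sub_le {F : Type*} [SeminormedAddCommGroup F]
    {s : Set F} {x p : F} (hp : p ∈ s) (hmin : ∀ z ∈ s, ‖x - p‖ ≤ ‖x - z‖) :
    Metric.infDist x s = ‖x - p‖ := by
  refine le_antisymm ((Metric.infDist_le_dist_of_mem hp).trans_eq (dist_eq_norm _ _)) ?_
  exact (Metric.le_infDist ⟨p, hp⟩).2 fun z hz => (hmin z hz).trans_eq (dist_eq_norm _ _).symm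

section InfDist

variable {F : Type*} [NormedAddCommGroup F] [InnerProductSpace ℝ F]

theorem Convex.inner_sub_le_zero_of_forall_norm_sub_le {s : Set F} (hs : Convex ℝ s) {x p : F}
    (hp : p ∈ s) (hmin : ∀ z ∈ s, ‖x - p‖ ≤ ‖x - z‖) {z : F} (hz : z ∈ s) :
    inner ℝ (x - p) (z - p) ≤ 0 := by
  have : Nonempty s := ⟨⟨p, hp⟩⟩
  refine (norm_eq_iInf_iff_real_inner_le_zero hs hp).1 ?_ z hz
  refine le_antisymm (le_ciInf fun w => hmin w w.2) ?_
  exact ciInf_le ⟨0, by rintro _ ⟨w, rfl⟩; exact norm_nonneg _⟩ (⟨p, hp⟩ : s)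

theorem Convex.norm_sub_le_of_forall_norm_sub_le {s : Set F} (hs : Convex ℝ s) {x y p q : F}
    (hp : p ∈ s) (hpmin : ∀ z ∈ s, ‖x - p‖ ≤ ‖x - z‖)
    (hq : q ∈ s) (hqmin : ∀ z ∈ s, ‖y - q‖ ≤ ‖y - z‖) : ‖p - q‖ ≤ ‖x - y‖ := by
  have h₁ := hs.inner_sub_le_zero_of_forall_norm_sub_le hp hpmin hq
  have h₂ := hs.inner_sub_le_zero_of_forall_norm_sub_le hq hqmin hp
  have h₃ : ‖p - q‖ * ‖p - q‖ =
      inner ℝ (x - y) (p - q) + inner ℝ (x - p) (q - p) + inner ℝ (y - q) (p - q) := by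
    rw [← real_inner_self_eq_norm_mul_norm]
    simp only [inner_sub_left, inner_sub_right]
    ring
  have h₄ := real_inner_le_norm (x - y) (p - q)
  by_contra! h
  nlinarith [norm_nonneg (x - y), norm_nonneg (p - q)]

theorem IsClosed.exists_forall_norm_sub_le [CompleteSpace F] {s : Set F} (hs : IsClosed s)
    (hne : s.Nonempty) (hcv : Convex ℝ s) (x : F) :
    ∃ p ∈ s, ∀ z ∈ s, ‖x - p‖ ≤ ‖x - z‖ := by
  obtain ⟨p, hp, h⟩ := exists_norm_eq_iInf_of_complete_convex hne hs.isComplete hcv x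
  refine ⟨p, hp, fun z hz => h.trans_le ?_⟩
  exact ciInf_le ⟨0, by rintro _ ⟨w, rfl⟩; exact norm_nonneg _⟩ (⟨z, hz⟩ : s)

theorem hasFDerivAt_norm_of_ne_zero {v : F} (hv : v ≠ 0) :
    HasFDerivAt (fun y : F => ‖y‖) (innerSL ℝ (‖v‖⁻¹ • v)) v := by
  have h := (hasStrictFDerivAt_norm_sq v).hasFDerivAt.sqrt (by positivity)
  simp only [Real.sqrt_sq (norm_nonneg _)] at h
  refine h.congr_fderiv ?_
  ext w
  have := norm_ne_zero_iff.2 hv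
  simp
  field_simp

theorem Convex.hasFDerivAt_infDist {s : Set F} (hs : Convex ℝ s) {x p : F} (hx : x ∉ s)
    (hp : p ∈ s) (hmin : ∀ z ∈ s, ‖x - p‖ ≤ ‖x - z‖) :
    HasFDerivAt (fun y => Metric.infDist y s) (innerSL ℝ (‖x - p‖⁻¹ • (x - p))) x := by
  have hxp : x - p ≠ 0 := sub_ne_zero.2 fun h => hx (h ▸ hp)
  have hpos : 0 < ‖x - p‖ := norm_pos_iff.2 hxp
  have hnorm : HasFDerivAt (fun y => ‖y - p‖) (innerSL ℝ (‖x - p‖⁻¹ • (x - p))) x :=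
    ((hasFDerivAt_norm_of_ne_zero hxp).comp x
      ((hasFDerivAt_id x).sub_const p)).congr_fderiv (ContinuousLinearMap.comp_id _)
  have hdist := Metric.infDist_eq_norm_sub_of_forall_norm_sub_le hp hmin
  have lower (y : F) :
      0 ≤ Metric.infDist y s - ‖x - p‖ - innerSL ℝ (‖x - p‖⁻¹ • (x - p)) (y - x) := by
    have hself : inner ℝ (‖x - p‖⁻¹ • (x - p)) (x - p) = ‖x - p‖ := by
      rw [real_inner_smul_left, real_inner_self_eq_norm_mul_norm]
      field_simp
    have hle : ‖x - p‖ + inner ℝ (‖x - p‖⁻¹ • (x - p)) (y - x) ≤ Metric.infDist y s := by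
      refine (Metric.le_infDist ⟨p, hp⟩).2 fun z hz => ?_
      have h₁ : inner ℝ (‖x - p‖⁻¹ • (x - p)) (z - p) ≤ 0 := by
        rw [real_inner_smul_left]
        exact mul_nonpos_of_nonneg_of_nonpos (by positivity)
          (hs.inner_sub_le_zero_of_forall_norm_sub_le hp hmin hz)
      have h₂ := real_inner_le_norm (‖x - p‖⁻¹ • (x - p)) (y - z)
      rw [norm_smul, norm_inv, norm_norm, inv_mul_cancel₀ hpos.ne', one_mul] at h₂
      rw [dist_eq_norm]
      have h₃ : y - x = (y - z) + (z - p) - (x - p) := by abel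
      rw [h₃, inner_sub_right, inner_add_right, hself]
      linarith
    rw [innerSL_apply_apply]
    linarith
  rw [hasFDerivAt_iff_isLittleO] at hnorm ⊢
  refine Asymptotics.IsBigO.trans_isLittleO (.of_norm_le fun y => ?_) hnorm
  have hle : Metric.infDist y s ≤ ‖y - p‖ :=
    (Metric.infDist_le_dist_of_mem hp).trans_eq (dist_eq_norm _ _)
  have hlow := lower y
  rw [hdist, Real.norm_of_nonneg hlow]
  exact sub_le_sub_right (sub_le_sub_right hle _) _

theorem Convex.contDiffOn_infDist_compl [CompleteSpace F] {s : Set F} (hcv : Convex ℝ s)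
    (hs : IsClosed s) (hne : s.Nonempty) :
    ContDiffOn ℝ 1 (fun y => Metric.infDist y s) sᶜ := by
  choose P hP hmin using hs.exists_forall_norm_sub_le hne hcv
  have hderiv (x : F) (hx : x ∈ sᶜ) := hcv.hasFDerivAt_infDist hx (hP x) (hmin x)
  have hcont : Continuous P := by
    refine (LipschitzWith.of_dist_le_mul (K := 1) fun x y => ?_).continuous
    simpa [dist_eq_norm] using
      hcv.norm_sub_le_of_forall_norm_sub_le (hP x) (hmin x) (hP y) (hmin y)
  rw [← zero_add (1 : WithTop ℕ∞), contDiffOn_succ_iff_fderiv_of_isOpen hs.isOpen_compl]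
  simp only [WithTop.zero_ne_top, false_implies, true_and, contDiffOn_zero]
  refine ⟨fun x hx => (hderiv x hx).differentiableAt.differentiableWithinAt, ?_⟩
  refine ContinuousOn.congr ?_ fun x hx => (hderiv x hx).fderiv
  refine (innerSL ℝ).continuous.comp_continuousOn (ContinuousOn.smul ?_ (by fun_prop))
  refine ContinuousOn.inv₀ (by fun_prop) fun x hx => ?_
  exact norm_ne_zero_iff.2 (sub_ne_zero.2 fun h => hx (h ▸ hP x))

end InfDist

/-- The value function `V_c(x_P, x_E) = dist(α, Ω) − β` of the Capture Game of
Degree is differentiable at every point with `x_P ≠ x_E` and `α ∉ Ω`, with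
partial gradients `(1/(1−γ²))(−γ²u + γw)` in `x_P` and `(1/(1−γ²))(u − γw)` in
`x_E`, where `u = (α − proj_Ω(α))/‖α − proj_Ω(α)‖` and
`w = (x_E − x_P)/‖x_E − x_P‖`; moreover `V_c` is `C¹` on the open set
`{(x_P, x_E) : x_P ≠ x_E, α ∉ Ω}`. -/
theorem capture_value_function_C1 (n : ℕ) (Ω : Set (EuclideanSpace ℝ (Fin n)))
    (hΩne : Ω.Nonempty) (hΩcl : IsClosed Ω) (hΩcv : Convex ℝ Ω)
    (γ : ℝ) (hγ0 : 0 < γ) (hγ1 : γ < 1)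
    (Vc : EuclideanSpace ℝ (Fin n) → EuclideanSpace ℝ (Fin n) → ℝ)
    (hVc : ∀ xP xE, Vc xP xE =
      Metric.infDist ((1 / (1 - γ ^ 2)) • (xE - γ ^ 2 • xP)) Ω -
        γ * ‖xE - xP‖ / (1 - γ ^ 2)) :
    (∀ xP xE : EuclideanSpace ℝ (Fin n), xP ≠ xE →
      (1 / (1 - γ ^ 2)) • (xE - γ ^ 2 • xP) ∉ Ω →
      ∀ p ∈ Ω, (∀ z ∈ Ω,
          ‖(1 / (1 - γ ^ 2)) • (xE - γ ^ 2 • xP) - p‖ ≤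
            ‖(1 / (1 - γ ^ 2)) • (xE - γ ^ 2 • xP) - z‖) →
        HasGradientAt (fun y => Vc y xE)
          ((1 / (1 - γ ^ 2)) •
            (-(γ ^ 2) • (‖(1 / (1 - γ ^ 2)) • (xE - γ ^ 2 • xP) - p‖⁻¹ •
                ((1 / (1 - γ ^ 2)) • (xE - γ ^ 2 • xP) - p)) +
              γ • (‖xE - xP‖⁻¹ • (xE - xP)))) xP ∧
        HasGradientAt (fun y => Vc xP y)
          ((1 / (1 - γ ^ 2)) •
            ((‖(1 / (1 - γ ^ 2)) • (xE - γ ^ 2 • xP) - p‖⁻¹ •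
                ((1 / (1 - γ ^ 2)) • (xE - γ ^ 2 • xP) - p)) -
              γ • (‖xE - xP‖⁻¹ • (xE - xP)))) xE) ∧
    ContDiffOn ℝ 1 (fun q : EuclideanSpace ℝ (Fin n) × EuclideanSpace ℝ (Fin n) =>
        Vc q.1 q.2)
      {q : EuclideanSpace ℝ (Fin n) × EuclideanSpace ℝ (Fin n) |
        q.1 ≠ q.2 ∧ (1 / (1 - γ ^ 2)) • (q.2 - γ ^ 2 • q.1) ∉ Ω} := by
  refine ⟨fun xP xE hne hα p hp hmin => ?_, ?_⟩
  · have hd := hΩcv.hasFDerivAt_infDist hα hp hmin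
    have hn := hasFDerivAt_norm_of_ne_zero (sub_ne_zero.2 hne.symm)
    simp only [hVc, hasGradientAt_iff_hasFDerivAt]
    constructor
    · have hα' :=
        (((hasFDerivAt_id (𝕜 := ℝ) xP).const_smul (γ ^ 2)).const_sub xE).const_smul
          (1 / (1 - γ ^ 2))
      have hβ := (hn.comp xP ((hasFDerivAt_id xP).const_sub xE)).const_mul (γ / (1 - γ ^ 2))
      refine (((hd.comp xP hα').sub hβ).congr_fderiv ?_).congr_of_eventuallyEq
        (.of_forall fun y => ?_)
      · ext v
        simp
        ring
      · simp
        ring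
    · have hα' :=
        ((hasFDerivAt_id (𝕜 := ℝ) xE).sub_const (γ ^ 2 • xP)).const_smul (1 / (1 - γ ^ 2))
      have hβ := (hn.comp xE ((hasFDerivAt_id xE).sub_const xP)).const_mul (γ / (1 - γ ^ 2))
      refine (((hd.comp xE hα').sub hβ).congr_fderiv ?_).congr_of_eventuallyEq
        (.of_forall fun y => ?_)
      · ext v
        simp
        ring
      · simp
        ring
  · simp only [hVc]
    refine ContDiffOn.sub ?_ ?_
    · refine (hΩcv.contDiffOn_infDist_compl hΩcl hΩne).comp
        (t := Ωᶜ) (f := fun q : EuclideanSpace ℝ (Fin n) × EuclideanSpace ℝ (Fin n) =>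
          (1 / (1 - γ ^ 2)) • (q.2 - γ ^ 2 • q.1)) ?_ fun q hq => hq.2
      exact ContDiff.contDiffOn (by fun_prop)
    · refine ContDiffOn.div_const (contDiffOn_const.mul ?_) _
      exact ContDiffOn.norm ℝ (ContDiff.contDiffOn (by fun_prop))
        fun q hq => sub_ne_zero.2 hq.1.symm
end

section
/- Let Ω ⊆ ℝⁿ be a nonempty closed convex set, let x_P ≠ x_E in ℝⁿ, let 0 < γ < 1, and assume dist(α, Ω) ≥ β and α ∉ Ω. Then the optimal capture point x* = α − β·(α − proj_Ω(α))/‖α − proj_Ω(α)‖ satisfies ‖x* − x_E‖ = γ‖x* − x_P‖ and dist(x*, Ω) = dist(α, Ω) − β; that is, x* lies on the Apollonius sphere and its distance from the target set equals the value of the barrier function. -/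
/-- Every point of the sphere centred at the Apollonius center with the Apollonius radius
has distances to `xE` and `xP` in the ratio `γ`. -/
theorem norm_sub_eq_mul_norm_sub_of_mem_apollonius_sphere {V : Type*}
    [NormedAddCommGroup V] [InnerProductSpace ℝ V] {xP xE x : V} {γ : ℝ}
    (hγ0 : 0 ≤ γ) (hγ1 : γ < 1)
    (hx : ‖x - (1 / (1 - γ ^ 2)) • (xE - γ ^ 2 • xP)‖ = γ * ‖xE - xP‖ / (1 - γ ^ 2)) :
    ‖x - xE‖ = γ * ‖x - xP‖ := by
  have hc : 1 - γ ^ 2 ≠ 0 := by nlinarith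
  set u := x - (1 / (1 - γ ^ 2)) • (xE - γ ^ 2 • xP) with hu
  have hE : x - xE = u + (γ ^ 2 / (1 - γ ^ 2)) • (xE - xP) := by
    rw [hu]
    match_scalars <;> field_simp <;> ring
  have hP : x - xP = u + (1 / (1 - γ ^ 2)) • (xE - xP) := by
    rw [hu]
    match_scalars <;> field_simp <;> ring
  rw [← sq_eq_sq₀ (norm_nonneg _) (by positivity), mul_pow, hE, hP, norm_add_sq_real,
    norm_add_sq_real, norm_smul, norm_smul, inner_smul_right, inner_smul_right, mul_pow, mul_pow,
    Real.norm_eq_abs, Real.norm_eq_abs, sq_abs, sq_abs, hx]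
  field_simp
  ring

/-- Moving from `a` by `r` towards a nearest point of `s` lowers the distance to `s` by `r`. -/
theorem infDist_sub_smul_of_nearest {V : Type*} [NormedAddCommGroup V] [NormedSpace ℝ V]
    {s : Set V} {a p : V} {r : ℝ} (hp : p ∈ s) (hap : 0 < ‖a - p‖)
    (hproj : Metric.infDist a s = ‖a - p‖) (hr0 : 0 ≤ r) (hr : r ≤ ‖a - p‖) :
    Metric.infDist (a - (r / ‖a - p‖) • (a - p)) s = Metric.infDist a s - r := by
  apply le_antisymm
  · refine (Metric.infDist_le_dist_of_mem hp).trans_eq ?_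
    have h : a - (r / ‖a - p‖) • (a - p) - p = (1 - r / ‖a - p‖) • (a - p) := by module
    have h1 : 0 ≤ 1 - r / ‖a - p‖ := sub_nonneg.2 ((div_le_one hap).2 hr)
    rw [dist_eq_norm, h, norm_smul, Real.norm_of_nonneg h1, hproj]
    field_simp
  · have h := Metric.infDist_le_infDist_add_dist (s := s) (x := a)
      (y := a - (r / ‖a - p‖) • (a - p))
    rw [dist_eq_norm, sub_sub_cancel, norm_smul, Real.norm_of_nonneg (by positivity),
      div_mul_cancel₀ _ hap.ne'] at h
    linarith

/-- If `dist(α, Ω) ≥ β` and `α ∉ Ω`, the optimal capture point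
`x* = α − β·(α − proj_Ω(α))/‖α − proj_Ω(α)‖` lies on the Apollonius sphere
(`‖x* − x_E‖ = γ‖x* − x_P‖`) and `dist(x*, Ω) = dist(α, Ω) − β`. -/
theorem capture_point_properties (n : ℕ) (Ω : Set (EuclideanSpace ℝ (Fin n)))
    (hΩne : Ω.Nonempty) (hΩcl : IsClosed Ω) (hΩcv : Convex ℝ Ω)
    (xP xE : EuclideanSpace ℝ (Fin n)) (hne : xP ≠ xE)
    (γ : ℝ) (hγ0 : 0 < γ) (hγ1 : γ < 1)
    (α : EuclideanSpace ℝ (Fin n)) (hα : α = (1 / (1 - γ ^ 2)) • (xE - γ ^ 2 • xP))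
    (β : ℝ) (hβ : β = γ * ‖xE - xP‖ / (1 - γ ^ 2))
    (hd : β ≤ Metric.infDist α Ω) (hαΩ : α ∉ Ω)
    (p : EuclideanSpace ℝ (Fin n)) (hp : p ∈ Ω)
    (hproj : ∀ z ∈ Ω, ‖α - p‖ ≤ ‖α - z‖)
    (xstar : EuclideanSpace ℝ (Fin n))
    (hx : xstar = α - (β / ‖α - p‖) • (α - p)) :
    ‖xstar - xE‖ = γ * ‖xstar - xP‖ ∧
      Metric.infDist xstar Ω = Metric.infDist α Ω - β := by
  have hap : 0 < ‖α - p‖ := norm_pos_iff.2 (sub_ne_zero.2 fun h => hαΩ (h ▸ hp))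
  have hβ0 : 0 ≤ β := by
    rw [hβ]
    exact div_nonneg (by positivity) (by nlinarith)
  have hD : Metric.infDist α Ω = ‖α - p‖ := by
    apply le_antisymm
    · rw [← dist_eq_norm]
      exact Metric.infDist_le_dist_of_mem hp
    · refine (Metric.le_infDist hΩne).2 fun z hz => ?_
      rw [dist_eq_norm]
      exact hproj z hz
  constructor
  · apply norm_sub_eq_mul_norm_sub_of_mem_apollonius_sphere hγ0.le hγ1
    rw [← hα, ← hβ, hx, sub_sub_cancel_left, norm_neg, norm_smul,
      Real.norm_of_nonneg (by positivity), div_mul_cancel₀ _ hap.ne']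
  · rw [hx]
    exact infDist_sub_smul_of_nearest hp hap hD hβ0 (hD ▸ hd)
end

section
/- Let Ω ⊆ ℝⁿ be a nonempty closed convex set, let x_P ≠ x_E in ℝⁿ, let 0 < γ < 1, and assume that the set K = Ω ∩ {z ∈ ℝⁿ : ‖z − x_E‖ ≤ γ‖z − x_P‖} is nonempty. Then the function φ(z) = −‖z − x_P‖ + ‖z − x_E‖/γ attains its minimum over K, and the minimizer x† is unique. -/
theorem norm_midpoint_sub_sq {V : Type*} [NormedAddCommGroup V] [InnerProductSpace ℝ V]
    (x y e : V) :
    ‖midpoint ℝ x y - e‖ ^ 2 = (‖x - e‖ ^ 2 + ‖y - e‖ ^ 2) / 2 - ‖x - y‖ ^ 2 / 4 := by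
  have hm : midpoint ℝ x y - e = (2⁻¹ : ℝ) • ((x - e) + (y - e)) := by
    rw [midpoint_eq_smul_add, invOf_eq_inv]
    module
  have hpar := parallelogram_law_with_norm ℝ (x - e) (y - e)
  rw [sub_sub_sub_cancel_right] at hpar
  rw [hm, norm_smul, Real.norm_of_nonneg (by norm_num)]
  linear_combination hpar / 4

theorem norm_midpoint_sub_le {V : Type*} [NormedAddCommGroup V] [NormedSpace ℝ V]
    (x y e : V) : ‖midpoint ℝ x y - e‖ ≤ (‖x - e‖ + ‖y - e‖) / 2 := by
  have hm : midpoint ℝ x y - e = (2⁻¹ : ℝ) • ((x - e) + (y - e)) := by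
    rw [midpoint_eq_smul_add, invOf_eq_inv]
    module
  rw [hm, norm_smul, Real.norm_of_nonneg (by norm_num)]
  linarith [norm_add_le (x - e) (y - e)]

/-- The inner region of a Cartesian oval is strictly midpoint convex. -/
theorem norm_midpoint_sub_add_lt {V : Type*} [NormedAddCommGroup V] [InnerProductSpace ℝ V]
    {x y e p : V} {γ r : ℝ} (hxy : x ≠ y) (hγ0 : 0 < γ) (hγ1 : γ < 1) (hr : 0 ≤ r)
    (hx : ‖x - e‖ + r ≤ γ * ‖x - p‖) (hy : ‖y - e‖ + r ≤ γ * ‖y - p‖) :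
    ‖midpoint ℝ x y - e‖ + r < γ * ‖midpoint ℝ x y - p‖ := by
  refine lt_of_pow_lt_pow_left₀ 2 (by positivity) ?_
  have hx2 := pow_le_pow_left₀ (by positivity) hx 2
  have hy2 := pow_le_pow_left₀ (by positivity) hy 2
  have hd : 0 < ‖x - y‖ ^ 2 := pow_pos (norm_pos_iff.mpr (sub_ne_zero.mpr hxy)) 2
  have hγ : 0 < (1 - γ ^ 2) * ‖x - y‖ ^ 2 := mul_pos (by nlinarith) hd
  have hle := mul_le_mul_of_nonneg_left (norm_midpoint_sub_le x y e) hr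
  rw [mul_pow, norm_midpoint_sub_sq x y p, add_sq, norm_midpoint_sub_sq x y e]
  linarith

/-- The closed Apollonius ball is compact. -/
theorem isCompact_setOf_norm_sub_le_mul {V : Type*} [NormedAddCommGroup V] [ProperSpace V]
    (e p : V) {γ : ℝ} (hγ0 : 0 < γ) (hγ1 : γ < 1) :
    IsCompact {z : V | ‖z - e‖ ≤ γ * ‖z - p‖} := by
  refine (isCompact_closedBall e (γ * ‖e - p‖ / (1 - γ))).of_isClosed_subset
    (isClosed_le (by fun_prop) (by fun_prop)) fun z hz => ?_
  rw [Set.mem_ofPred_eq] at hz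
  rw [mem_closedBall_iff_norm, le_div_iff₀ (by linarith)]
  have := mul_le_mul_of_nonneg_left (norm_sub_le_norm_sub_add_norm_sub z e p) hγ0.le
  linarith

/-- If `K = Ω ∩ {z : ‖z − x_E‖ ≤ γ‖z − x_P‖}` is nonempty (with `Ω` nonempty,
closed, and convex), then `φ(z) = −‖z − x_P‖ + ‖z − x_E‖/γ` attains its minimum
over `K` at a unique point `x†`. -/
theorem attack_point_exists_unique (n : ℕ) (Ω : Set (EuclideanSpace ℝ (Fin n)))
    (hΩne : Ω.Nonempty) (hΩcl : IsClosed Ω) (hΩcv : Convex ℝ Ω)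
    (xP xE : EuclideanSpace ℝ (Fin n)) (hne : xP ≠ xE)
    (γ : ℝ) (hγ0 : 0 < γ) (hγ1 : γ < 1)
    (K : Set (EuclideanSpace ℝ (Fin n)))
    (hK : K = Ω ∩ {z | ‖z - xE‖ ≤ γ * ‖z - xP‖})
    (hKne : K.Nonempty) :
    ∃! xdag : EuclideanSpace ℝ (Fin n), xdag ∈ K ∧
      ∀ z ∈ K, -‖xdag - xP‖ + ‖xdag - xE‖ / γ ≤ -‖z - xP‖ + ‖z - xE‖ / γ := by
  have hcpt : IsCompact K := hK ▸ (isCompact_setOf_norm_sub_le_mul xE xP hγ0 hγ1).inter_left hΩcl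
  obtain ⟨x, hxK, hx⟩ := hcpt.exists_isMinOn hKne
    (f := fun z => -‖z - xP‖ + ‖z - xE‖ / γ) (by fun_prop)
  rw [isMinOn_iff] at hx
  refine ⟨x, ⟨hxK, hx⟩, ?_⟩
  rintro y ⟨hyK, hy⟩
  by_contra hyx
  have hmul (z : EuclideanSpace ℝ (Fin n)) :
      γ * (-‖z - xP‖ + ‖z - xE‖ / γ) = ‖z - xE‖ - γ * ‖z - xP‖ := by
    field_simp
    ring
  have hyx_le := mul_le_mul_of_nonneg_left (hy x hxK) hγ0.le
  rw [hmul, hmul] at hyx_le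
  rw [hK] at hxK hyK
  have hr : 0 ≤ γ * ‖x - xP‖ - ‖x - xE‖ := sub_nonneg.mpr hxK.2
  have hlt := norm_midpoint_sub_add_lt (e := xE) (p := xP) hyx hγ0 hγ1 hr
    (by linarith) (by linarith)
  have hmK : midpoint ℝ y x ∈ K := by
    rw [hK]
    refine ⟨hΩcv.midpoint_mem hyK.1 hxK.1, ?_⟩
    rw [Set.mem_ofPred_eq]
    linarith
  have hmin := mul_le_mul_of_nonneg_left (hx _ hmK) hγ0.le
  rw [hmul, hmul] at hmin
  linarith
end

section
/- Let x_P, z ∈ ℝⁿ, 0 < γ < 1, and r > 0, and let α = (z − γ²x_P)/(1 − γ²), β = γ‖z − x_P‖/(1 − γ²). Assume ‖α‖ ≥ r. Then dist(α, closedBall(0, r)) − β = 0 if and only if ‖z − γ²x_P‖ − γ‖z − x_P‖ − (1 − γ²)r = 0. Hence the projection of the barrier surface for the ball target Ω = closedBall(0, r) is the Cartesian oval {z : ‖z − γ²x_P‖ − γ‖z − x_P‖ = (1 − γ²)r}. -/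
/-- The distance from a point outside a ball centred at the origin to that ball. -/
theorem infDist_closedBall_zero_of_le_norm {E : Type*} [NormedAddCommGroup E] [NormedSpace ℝ E]
    {x : E} {r : ℝ} (hr : 0 < r) (hx : r ≤ ‖x‖) :
    Metric.infDist x (Metric.closedBall 0 r) = ‖x‖ - r := by
  have hx0 : 0 < ‖x‖ := hr.trans_le hx
  apply le_antisymm
  · have hmem : (r / ‖x‖) • x ∈ Metric.closedBall (0 : E) r := by
      rw [mem_closedBall_zero_iff, norm_smul, Real.norm_of_nonneg (by positivity),
        div_mul_cancel₀ _ hx0.ne']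
    refine (Metric.infDist_le_dist_of_mem hmem).trans_eq ?_
    have hsub : x - (r / ‖x‖) • x = (1 - r / ‖x‖) • x := by rw [sub_smul, one_smul]
    have hnonneg : 0 ≤ 1 - r / ‖x‖ := sub_nonneg.2 ((div_le_one hx0).2 hx)
    rw [dist_eq_norm, hsub, norm_smul, Real.norm_of_nonneg hnonneg, sub_mul, one_mul,
      div_mul_cancel₀ _ hx0.ne']
  · refine (Metric.le_infDist (Metric.nonempty_closedBall.2 hr.le)).2 fun y hy => ?_
    rw [mem_closedBall_zero_iff] at hy
    rw [dist_eq_norm]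
    linarith [norm_sub_norm_le x y]

/-- Ball target: for `Ω = closedBall(0, r)` and `‖α‖ ≥ r`, the barrier condition
`dist(α, Ω) − β = 0` is equivalent to the Cartesian-oval equation
`‖z − γ²x_P‖ − γ‖z − x_P‖ − (1 − γ²)r = 0`, where
`α = (z − γ²x_P)/(1 − γ²)` and `β = γ‖z − x_P‖/(1 − γ²)`. -/
theorem ball_target_barrier (n : ℕ)
    (xP z : EuclideanSpace ℝ (Fin n)) (γ r : ℝ)
    (hγ0 : 0 < γ) (hγ1 : γ < 1) (hr : 0 < r)
    (α : EuclideanSpace ℝ (Fin n)) (hα : α = (1 / (1 - γ ^ 2)) • (z - γ ^ 2 • xP))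
    (β : ℝ) (hβ : β = γ * ‖z - xP‖ / (1 - γ ^ 2))
    (hαr : r ≤ ‖α‖) :
    Metric.infDist α (Metric.closedBall (0 : EuclideanSpace ℝ (Fin n)) r) - β = 0 ↔
      ‖z - γ ^ 2 • xP‖ - γ * ‖z - xP‖ - (1 - γ ^ 2) * r = 0 := by
  have hγ : 0 < 1 - γ ^ 2 := by nlinarith
  have hnorm : ‖α‖ = ‖z - γ ^ 2 • xP‖ / (1 - γ ^ 2) := by
    rw [hα, norm_smul, Real.norm_of_nonneg (by positivity), one_div_mul_eq_div]
  have key : ‖α‖ - r - β =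
      (‖z - γ ^ 2 • xP‖ - γ * ‖z - xP‖ - (1 - γ ^ 2) * r) / (1 - γ ^ 2) := by
    rw [hnorm, hβ]
    field_simp
    ring
  rw [infDist_closedBall_zero_of_le_norm hr hαr, key, div_eq_zero_iff, or_iff_left hγ.ne']
end

section
/- Let p, q ∈ ℝⁿ with p ≠ q, let v ∈ ℝⁿ with v ≠ 0, let 0 < γ < 1, and suppose ξ ∈ ℝ satisfies ‖v‖²ξ² + 2γ²⟨q − p, v⟩ξ − γ²(1 − γ²)‖q − p‖² = 0. Define e = vξ + γ²q + (1 − γ²)p. Then ‖p − e‖ = γ‖p − q‖. -/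
open RealInnerProductSpace

/-- If `ξ` solves `‖v‖²ξ² + 2γ²⟨q − p, v⟩ξ − γ²(1 − γ²)‖q − p‖² = 0`, then the
point `e = vξ + γ²q + (1 − γ²)p` satisfies `‖p − e‖ = γ‖p − q‖`; i.e. `p` lies on
the Apollonius sphere determined by pursuer position `q` and evader position `e`. -/
theorem barrier_map_point_on_apollonius (n : ℕ)
    (p q v : EuclideanSpace ℝ (Fin n)) (hpq : p ≠ q) (hv : v ≠ 0)
    (γ : ℝ) (hγ0 : 0 < γ) (hγ1 : γ < 1) (ξ : ℝ)
    (hξ : ‖v‖ ^ 2 * ξ ^ 2 + 2 * γ ^ 2 * ⟪q - p, v⟫ * ξ -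
        γ ^ 2 * (1 - γ ^ 2) * ‖q - p‖ ^ 2 = 0)
    (e : EuclideanSpace ℝ (Fin n)) (he : e = ξ • v + γ ^ 2 • q + (1 - γ ^ 2) • p) :
    ‖p - e‖ = γ * ‖p - q‖ := by
  have hpe : ‖p - e‖ = ‖ξ • v + γ ^ 2 • (q - p)‖ := by
    rw [norm_sub_rev, he]
    congr 1
    module
  have hsq : ‖p - e‖ ^ 2 = (γ * ‖p - q‖) ^ 2 := by
    rw [hpe, norm_add_sq_real, norm_smul, norm_smul, real_inner_smul_left,
      real_inner_smul_right, real_inner_comm, norm_sub_rev p q, mul_pow, mul_pow,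
      Real.norm_eq_abs, Real.norm_eq_abs, sq_abs, sq_abs]
    linear_combination hξ
  exact (sq_eq_sq₀ (norm_nonneg _) (by positivity)).mp hsq
end
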